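/- arXiv:2107.04468 — 2 statements merged into one kernel-verified Lean document; each statement's English description precedes it below -/
import Mathlib

section
/- Let S be a nonempty convex subset of ℝ^N and let f : S → ℝ be strictly quasiconvex, i.e. for all x₁, x₂ ∈ S with f(x₁) ≠ f(x₂) and all λ ∈ (0,1), f(λx₁ + (1−λ)x₂) < max{f(x₁), f(x₂)}. Then every local minimizer of f on S is a global minimizer of f on S: if x̄ ∈ S and there is ε > 0 such that f(x̄) ≤ f(x) for all x ∈ S with ‖x − x̄‖ < ε, then f(x̄) ≤ f(x) for all x ∈ S. -/
/-- **For a strictly quasiconvex function, every local minimizer is a global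
minimizer.** If `S ⊆ ℝ^N` is nonempty and convex and `f : S → ℝ` satisfies
`f(λx₁ + (1−λ)x₂) < max{f(x₁), f(x₂)}` whenever `x₁, x₂ ∈ S` with
`f(x₁) ≠ f(x₂)` and `λ ∈ (0,1)`, then any point `x̄ ∈ S` that minimizes `f` on
an `ε`-neighbourhood of `x̄` in `S` minimizes `f` on all of `S`. -/
theorem strictly_quasiconvex_local_min_is_global
    {N : ℕ} (S : Set (EuclideanSpace ℝ (Fin N))) (hS : S.Nonempty)
    (hconv : Convex ℝ S)
    (f : EuclideanSpace ℝ (Fin N) → ℝ)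
    (hsq : ∀ x₁ ∈ S, ∀ x₂ ∈ S, f x₁ ≠ f x₂ → ∀ l : ℝ, l ∈ Set.Ioo (0 : ℝ) 1 →
      f (l • x₁ + (1 - l) • x₂) < max (f x₁) (f x₂))
    (xbar : EuclideanSpace ℝ (Fin N)) (hxbar : xbar ∈ S)
    (ε : ℝ) (hε : 0 < ε)
    (hloc : ∀ x ∈ S, ‖x - xbar‖ < ε → f xbar ≤ f x) :
    ∀ x ∈ S, f xbar ≤ f x := by
  intro x hx
  by_contra! hlt
  have hd : 0 ≤ ‖x - xbar‖ := norm_nonneg _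
  have hpos : 0 < ε + ‖x - xbar‖ + 1 := by linarith
  obtain ⟨l, hl⟩ : ∃ l : ℝ, l = ε / (ε + ‖x - xbar‖ + 1) := ⟨_, rfl⟩
  have hl0 : 0 < l := by rw [hl]; positivity
  have hl1 : l < 1 := by rw [hl, div_lt_one hpos]; linarith
  have hmem : l • x + (1 - l) • xbar ∈ S :=
    hconv hx hxbar hl0.le (by linarith) (by ring)
  have h1 := hsq x hx xbar hxbar hlt.ne l ⟨hl0, hl1⟩
  rw [max_eq_right hlt.le] at h1
  have heq : l • x + (1 - l) • xbar - xbar = l • (x - xbar) := by module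
  have hnorm : ‖l • x + (1 - l) • xbar - xbar‖ < ε := by
    rw [heq, norm_smul, Real.norm_of_nonneg hl0.le]
    have hmul : l * (ε + ‖x - xbar‖ + 1) = ε := by
      rw [hl]; exact div_mul_cancel₀ _ hpos.ne'
    have : 0 < l * ε := mul_pos hl0 hε
    linarith
  exact absurd (hloc _ hmem hnorm) (not_le.mpr h1)
end

section
/- Let K₁, …, K_N be symmetric positive semidefinite m × m real matrices, let F ∈ ℝ^m, and define K(ρ) = Σ_{i=1}^N ρ_i K_i for ρ ∈ ℝ^N. Let S = {ρ ∈ ℝ^N : ρ_i ≥ 0 for all i and K(ρ) is positive definite}. Then S is a convex set, and the compliance function c(ρ) = Fᵀ K(ρ)^{-1} F is a convex function on S. (This is the convexity of the relaxed variable thickness sheet compliance minimization problem, in which stiffness depends linearly on the design variables.) -/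
open Matrix

lemma aux_mul_inv {m : ℕ} {A : Matrix (Fin m) (Fin m) ℝ} (hA : A.PosDef) (F : Fin m → ℝ) :
    A *ᵥ (A⁻¹ *ᵥ F) = F := by
  have h := (Matrix.isUnit_iff_isUnit_det A).1 hA.isUnit
  rw [Matrix.mulVec_mulVec, Matrix.mul_nonsing_inv _ h, Matrix.one_mulVec]

/-- Complementary energy bound. -/
lemma aux_energy {m : ℕ} {A : Matrix (Fin m) (Fin m) ℝ} (hA : A.PosDef) (F u : Fin m → ℝ) :
    2 * (F ⬝ᵥ u) - u ⬝ᵥ A *ᵥ u ≤ F ⬝ᵥ A⁻¹ *ᵥ F := by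
  have hw := aux_mul_inv hA F
  set w := A⁻¹ *ᵥ F with hwdef
  have h := hA.posSemidef.dotProduct_mulVec_nonneg (u - w)
  have hT : Aᵀ = A := by simpa using hA.isHermitian.eq
  have hs : w ⬝ᵥ A *ᵥ u = F ⬝ᵥ u := by
    rw [Matrix.dotProduct_mulVec, ← Matrix.mulVec_transpose, hT, hw]
  simp only [star_trivial, Matrix.mulVec_sub, hw, sub_dotProduct, dotProduct_sub, hs] at h
  rw [dotProduct_comm u F, dotProduct_comm w F] at h
  linarith

/-- **Convexity of the variable thickness sheet compliance problem.**
With symmetric positive semidefinite elemental stiffness matrices `K_i`, the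
linearly assembled stiffness `K(ρ) = Σ_i ρ_i K_i`, and the set
`S = {ρ : ρ_i ≥ 0 ∀i, K(ρ) positive definite}`, the set `S` is convex and the
compliance `c(ρ) = Fᵀ K(ρ)⁻¹ F` is a convex function on `S`. -/
theorem variable_thickness_sheet_compliance_convex
    {N m : ℕ} (K : Fin N → Matrix (Fin m) (Fin m) ℝ)
    (hKsymm : ∀ i, (K i).IsSymm) (hKpsd : ∀ i, (K i).PosSemidef)
    (F : Fin m → ℝ)
    (S : Set (Fin N → ℝ))
    (hS : S = {ρ : Fin N → ℝ |
      (∀ i, 0 ≤ ρ i) ∧ (∑ i, ρ i • K i).PosDef}) :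
    Convex ℝ S ∧
    ConvexOn ℝ S (fun ρ : Fin N → ℝ =>
      F ⬝ᵥ ((∑ i, ρ i • K i)⁻¹).mulVec F) := by
  have hlin : ∀ (x y : Fin N → ℝ) (a b : ℝ), (∑ i, (a • x + b • y) i • K i)
      = a • (∑ i, x i • K i) + b • (∑ i, y i • K i) := by
    intro x y a b
    simp only [Finset.smul_sum, ← Finset.sum_add_distrib, Pi.add_apply, Pi.smul_apply, smul_eq_mul,
      add_smul, mul_smul]
  have hconv : Convex ℝ S := by
    subst hS
    rintro x ⟨hx, hxp⟩ y ⟨hy, hyp⟩ a b ha hb hab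
    refine ⟨fun i => ?_, ?_⟩
    · have := mul_nonneg ha (hx i)
      have := mul_nonneg hb (hy i)
      simp only [Pi.add_apply, Pi.smul_apply, smul_eq_mul]
      linarith
    · rw [hlin]
      rcases ha.eq_or_lt with h0 | h0
      · have hb1 : b = 1 := by linarith
        rw [← h0, hb1, zero_smul, zero_add, one_smul]
        exact hyp
      · exact (hxp.smul h0).add_posSemidef (hyp.posSemidef.smul hb)
  refine ⟨hconv, hconv, ?_⟩
  intro x hx y hy a b ha hb hab
  have hz := hconv hx hy ha hb hab
  rw [hS] at hx hy hz
  have hzp := hz.2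
  simp only [smul_eq_mul]
  rw [hlin] at hzp ⊢
  have hxp := hx.2
  have hyp := hy.2
  generalize (∑ i, x i • K i) = A at *
  generalize (∑ i, y i • K i) = B at *
  have hu := aux_mul_inv hzp F
  generalize (a • A + b • B)⁻¹ *ᵥ F = u at *
  have h1 := mul_le_mul_of_nonneg_left (aux_energy hxp F u) ha
  have h2 := mul_le_mul_of_nonneg_left (aux_energy hyp F u) hb
  have h3 : a * (u ⬝ᵥ A *ᵥ u) + b * (u ⬝ᵥ B *ᵥ u) = F ⬝ᵥ u := by
    rw [dotProduct_comm F u, ← hu]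
    simp only [Matrix.add_mulVec, Matrix.smul_mulVec, dotProduct_add, dotProduct_smul, smul_eq_mul]
  have h4 : a * (F ⬝ᵥ u) + b * (F ⬝ᵥ u) = F ⬝ᵥ u := by rw [← add_mul, hab, one_mul]
  linarith
end
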